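/- arXiv:2504.01497 — 4 statements merged into one kernel-verified Lean document; each statement's English description precedes it below -/
import Mathlib

section
/- Consider the modified-symplectic-derived algorithm with step size s = 1/(4L), Δ₁ = √μ/(2√L − √μ), and any Δ₂ with 1/(2(2√L − √μ)) ≤ Δ₂ ≤ 1/(2√L − √μ): x_{k+1} = x_k + ((2√L − √μ)/(2√L + √μ))(x_k − x_{k−1}) − (1/(4L − μ))∇f(x_k) − (Δ₂/(2√L − √μ))(∇f(x_k) − ∇f(x_{k−1})), with x₁ = x₀. Then there exists a constant C ≥ 0 such that for all k ≥ 0, f(x_k) − f(x*) ≤ C·(1 + (1/2)√(μ/L))^{−k}. -/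
open scoped RealInnerProductSpace

section SmoothConvex

variable {H : Type*} [NormedAddCommGroup H] [InnerProductSpace ℝ H]

theorem hasDerivAt_comp_add_smul [CompleteSpace H] {f : H → ℝ} (hf : Differentiable ℝ f)
    (x d : H) (t : ℝ) :
    HasDerivAt (fun t : ℝ => f (x + t • d)) ⟪gradient f (x + t • d), d⟫ t := by
  have hline : HasDerivAt (fun t : ℝ => x + t • d) d t := by
    simpa using ((hasDerivAt_id t).smul_const d).const_add x
  have h := (hf (x + t • d)).hasFDerivAt.comp_hasDerivAt t hline
  rw [inner_gradient_left]
  exact h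

theorem strongConvexOn_gradient_lower_bound [CompleteSpace H] {f : H → ℝ} {μ : ℝ}
    (hf : Differentiable ℝ f) (hsc : StrongConvexOn Set.univ μ f) (x y : H) :
    f x + ⟪gradient f x, y - x⟫ + μ / 2 * ‖y - x‖ ^ 2 ≤ f y := by
  have hd := hasDerivAt_comp_add_smul hf x (y - x) 0
  have hslope := hd.tendsto_slope_zero_right
  have hrhs : Filter.Tendsto (fun t : ℝ => f y - f x - (1 - t) * (μ / 2 * ‖y - x‖ ^ 2))
      (nhdsWithin 0 (Set.Ioi 0)) (nhds (f y - f x - (1 - 0) * (μ / 2 * ‖y - x‖ ^ 2))) := by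
    refine Filter.Tendsto.mono_left ?_ nhdsWithin_le_nhds
    exact Continuous.tendsto (by fun_prop) 0
  have hle := le_of_tendsto_of_tendsto hslope hrhs ?_
  · simp only [zero_smul, add_zero] at hle
    linarith
  · filter_upwards [Ioo_mem_nhdsGT (zero_lt_one' ℝ)] with t ht
    have hc := And.right hsc (Set.mem_univ x) (Set.mem_univ y)
      (sub_nonneg.2 ht.2.le) ht.1.le (sub_add_cancel 1 t)
    have hpt : (1 - t) • x + t • y = x + t • (y - x) := by module
    rw [hpt, norm_sub_rev x y] at hc
    simp only [smul_eq_mul, zero_add, zero_smul, add_zero] at hc ⊢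
    rw [inv_mul_le_iff₀ ht.1]
    nlinarith

theorem gradient_lipschitz_upper_bound [CompleteSpace H] {f : H → ℝ} {L : ℝ}
    (hf : Differentiable ℝ f)
    (hL : ∀ x y, ‖gradient f x - gradient f y‖ ≤ L * ‖x - y‖) (x y : H) :
    f y ≤ f x + ⟪gradient f x, y - x⟫ + L / 2 * ‖y - x‖ ^ 2 := by
  set d := y - x with hd
  let φ : ℝ → ℝ := fun t =>
    f (x + t • d) - t * ⟪gradient f x, d⟫ - t ^ 2 * (L / 2 * ‖d‖ ^ 2)
  have hφ : ∀ t, HasDerivAt φ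
      (⟪gradient f (x + t • d), d⟫ - ⟪gradient f x, d⟫ - 2 * t * (L / 2 * ‖d‖ ^ 2)) t := by
    intro t
    have h1 := (hasDerivAt_id t).mul_const ⟪gradient f x, d⟫
    have h2 := (hasDerivAt_pow 2 t).mul_const (L / 2 * ‖d‖ ^ 2)
    have h := ((hasDerivAt_comp_add_smul hf x d t).sub h1).sub h2
    exact HasDerivAt.congr_deriv h (by norm_num)
  have hanti : AntitoneOn φ (Set.Icc 0 1) := by
    refine antitoneOn_of_deriv_nonpos (convex_Icc 0 1)
      (fun t _ => (hφ t).continuousAt.continuousWithinAt)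
      (fun t _ => (hφ t).differentiableAt.differentiableWithinAt) ?_
    intro t ht
    rw [interior_Icc] at ht
    rw [(hφ t).deriv, ← inner_sub_left]
    have hn := hL (x + t • d) x
    rw [add_sub_cancel_left, norm_smul, Real.norm_of_nonneg ht.1.le] at hn
    have hcs := real_inner_le_norm (gradient f (x + t • d) - gradient f x) d
    nlinarith [mul_le_mul_of_nonneg_right hn (norm_nonneg d)]
  have h01 := hanti (Set.left_mem_Icc.2 zero_le_one) (Set.right_mem_Icc.2 zero_le_one)
    zero_le_one
  simp only [φ, one_smul, zero_smul, add_zero, hd, add_sub_cancel] at h01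
  rw [hd]
  linarith

/-- The interpolation inequality for a function squeezed between its tangent planes and the
corresponding paraboloids of curvature `M`. -/
theorem tangent_add_norm_sq_le_of_bounds {φ : H → ℝ} {p : H → H} {M : ℝ} (hM : 0 < M)
    (hlow : ∀ x y, φ x + ⟪p x, y - x⟫ ≤ φ y)
    (hupp : ∀ x y, φ y ≤ φ x + ⟪p x, y - x⟫ + M / 2 * ‖y - x‖ ^ 2) (x y : H) :
    φ y + ⟪p y, x - y⟫ + 1 / (2 * M) * ‖p x - p y‖ ^ 2 ≤ φ x := by
  have h1 := hlow y (x - M⁻¹ • (p x - p y))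
  have h2 := hupp x (x - M⁻¹ • (p x - p y))
  have e1 : x - M⁻¹ • (p x - p y) - x = -(M⁻¹ • (p x - p y)) := by abel
  have e2 : x - M⁻¹ • (p x - p y) - y = (x - y) - M⁻¹ • (p x - p y) := by abel
  rw [e2, inner_sub_right, real_inner_smul_right] at h1
  rw [e1, inner_neg_right, real_inner_smul_right, norm_neg, norm_smul, Real.norm_eq_abs,
    mul_pow, sq_abs] at h2
  have e3 : ⟪p x, p x - p y⟫ - ⟪p y, p x - p y⟫ = ‖p x - p y‖ ^ 2 := by
    rw [← inner_sub_left, real_inner_self_eq_norm_sq]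
  have e4 : M / 2 * (M⁻¹ ^ 2 * ‖p x - p y‖ ^ 2) = 1 / (2 * M) * ‖p x - p y‖ ^ 2 := by
    field_simp
  have e5 : M⁻¹ * ‖p x - p y‖ ^ 2 = 2 * (1 / (2 * M) * ‖p x - p y‖ ^ 2) := by
    field_simp
  have e6 := congrArg (M⁻¹ * ·) e3
  simp only [mul_sub] at e6
  linarith

/-- The gradient of an `m`-strongly convex, `1`-smooth function lies in the sector `[m, 1]`. -/
theorem sector_of_bounds {φ : H → ℝ} {p : H → H} {m : ℝ} (hm : m < 1)
    (hlow : ∀ x y, φ x + ⟪p x, y - x⟫ + m / 2 * ‖y - x‖ ^ 2 ≤ φ y)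
    (hupp : ∀ x y, φ y ≤ φ x + ⟪p x, y - x⟫ + 1 / 2 * ‖y - x‖ ^ 2) (hp : p 0 = 0) (x : H) :
    0 ≤ ⟪p x - m • x, x - p x⟫ := by
  have key : ∀ x y : H, ‖y - x‖ ^ 2 = ‖y‖ ^ 2 - 2 * ⟪x, y - x⟫ - ‖x‖ ^ 2 := by
    intro x y
    rw [norm_sub_sq_real, inner_sub_right, real_inner_self_eq_norm_sq, real_inner_comm]
    ring
  have hM : 0 < 1 - m := by linarith
  have h := tangent_add_norm_sq_le_of_bounds (φ := fun z => φ z - m / 2 * ‖z‖ ^ 2)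
    (p := fun z => p z - m • z) hM
    (fun x y => by
      have h := hlow x y
      have k := key x y
      simp only [inner_sub_left, real_inner_smul_left]
      rw [k] at h
      linarith)
    (fun x y => by
      have h := hupp x y
      have k := key x y
      simp only [inner_sub_left, real_inner_smul_left]
      rw [k] at h ⊢
      linarith)
  have h1 := h x 0
  have h2 := h 0 x
  simp only [hp, smul_zero, sub_zero, zero_sub, inner_zero_left, norm_neg, norm_zero,
    inner_neg_right] at h1 h2
  have h3 : 2 * (1 / (2 * (1 - m)) * ‖p x - m • x‖ ^ 2) ≤ ⟪p x - m • x, x⟫ := by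
    linarith
  have h4 : ‖p x - m • x‖ ^ 2 ≤ (1 - m) * ⟪p x - m • x, x⟫ := by
    have := mul_le_mul_of_nonneg_left h3 hM.le
    have e : (1 - m) * (2 * (1 / (2 * (1 - m)) * ‖p x - m • x‖ ^ 2)) = ‖p x - m • x‖ ^ 2 := by
      field_simp
    linarith
  have e : x - p x = (1 - m) • x - (p x - m • x) := by module
  rw [e, inner_sub_right, real_inner_smul_right, real_inner_self_eq_norm_sq]
  linarith

end SmoothConvex

section QuadraticForms

variable {H : Type*} [NormedAddCommGroup H] [InnerProductSpace ℝ H]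

theorem quadForm_two_nonneg {a b c : ℝ} (ha : 0 < a) (hdet : b ^ 2 ≤ a * c) (x y : H) :
    0 ≤ a * ‖x‖ ^ 2 + 2 * b * ⟪x, y⟫ + c * ‖y‖ ^ 2 := by
  have hsq : ‖a • x + b • y‖ ^ 2 = a ^ 2 * ‖x‖ ^ 2 + 2 * (a * b) * ⟪x, y⟫ + b ^ 2 * ‖y‖ ^ 2 := by
    rw [norm_add_sq_real, norm_smul, norm_smul, real_inner_smul_left, real_inner_smul_right,
      mul_pow, mul_pow, Real.norm_eq_abs, Real.norm_eq_abs, sq_abs, sq_abs]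
    ring
  have h := mul_le_mul_of_nonneg_right hdet (sq_nonneg ‖y‖)
  refine nonneg_of_mul_nonneg_right (?_ : 0 ≤ a * _) ha
  nlinarith [sq_nonneg ‖a • x + b • y‖]

theorem quadForm_three_nonneg {a₁₁ a₁₂ a₂₂ a₁₃ a₂₃ a₃₃ : ℝ} (h₁ : 0 < a₁₁)
    (h₂ : 0 < a₁₁ * a₂₂ - a₁₂ ^ 2)
    (h₃ : (a₁₁ * a₂₃ - a₁₂ * a₁₃) ^ 2 ≤ (a₁₁ * a₂₂ - a₁₂ ^ 2) * (a₁₁ * a₃₃ - a₁₃ ^ 2))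
    (x y z : H) :
    0 ≤ a₁₁ * ‖x‖ ^ 2 + 2 * a₁₂ * ⟪x, y⟫ + a₂₂ * ‖y‖ ^ 2 + 2 * a₁₃ * ⟪x, z⟫
      + 2 * a₂₃ * ⟪y, z⟫ + a₃₃ * ‖z‖ ^ 2 := by
  have hsq : ‖a₁₁ • x + (a₁₂ • y + a₁₃ • z)‖ ^ 2 = a₁₁ ^ 2 * ‖x‖ ^ 2 + a₁₂ ^ 2 * ‖y‖ ^ 2
      + a₁₃ ^ 2 * ‖z‖ ^ 2 + 2 * (a₁₁ * a₁₂) * ⟪x, y⟫ + 2 * (a₁₁ * a₁₃) * ⟪x, z⟫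
      + 2 * (a₁₂ * a₁₃) * ⟪y, z⟫ := by
    simp only [norm_add_sq_real, norm_smul, inner_add_right, real_inner_smul_left,
      real_inner_smul_right, mul_pow, Real.norm_eq_abs, sq_abs]
    ring
  have h := quadForm_two_nonneg h₂ h₃ y z
  refine nonneg_of_mul_nonneg_right (?_ : 0 ≤ a₁₁ * _) h₁
  linarith [sq_nonneg ‖a₁₁ • x + (a₁₂ • y + a₁₃ • z)‖]

/-- A form in four vectors whose last vector is coupled only to the third one. -/
theorem quadForm_four_nonneg {a₁₁ a₁₂ a₂₂ a₁₃ a₂₃ a₃₃ a₃₄ a₄₄ : ℝ} (h₁ : 0 < a₁₁)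
    (h₂ : 0 < a₁₁ * a₂₂ - a₁₂ ^ 2) (h₄ : 0 < a₄₄)
    (h₃ : 0 ≤ (a₁₁ * a₂₂ - a₁₂ ^ 2) * (a₁₁ * (a₃₃ * a₄₄ - a₃₄ ^ 2) - a₁₃ ^ 2 * a₄₄)
      - (a₁₁ * a₂₃ - a₁₂ * a₁₃) ^ 2 * a₄₄)
    (x y z w : H) :
    0 ≤ a₁₁ * ‖x‖ ^ 2 + 2 * a₁₂ * ⟪x, y⟫ + a₂₂ * ‖y‖ ^ 2 + 2 * a₁₃ * ⟪x, z⟫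
      + 2 * a₂₃ * ⟪y, z⟫ + a₃₃ * ‖z‖ ^ 2 + 2 * a₃₄ * ⟪z, w⟫ + a₄₄ * ‖w‖ ^ 2 := by
  have h3 := quadForm_three_nonneg (a₁₃ := a₁₃) (a₂₃ := a₂₃) (a₃₃ := a₃₃ - a₃₄ ^ 2 / a₄₄) h₁ h₂
    (by
      refine le_of_mul_le_mul_right ?_ h₄
      have e : (a₁₁ * (a₃₃ - a₃₄ ^ 2 / a₄₄) - a₁₃ ^ 2) * a₄₄
          = a₁₁ * (a₃₃ * a₄₄ - a₃₄ ^ 2) - a₁₃ ^ 2 * a₄₄ := by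
        field_simp
      rw [mul_assoc, e]
      linarith) x y z
  have h4 := quadForm_two_nonneg (a := a₄₄) (b := a₃₄) (c := a₃₄ ^ 2 / a₄₄) h₄
    (by rw [mul_div_cancel₀ _ h₄.ne']) w z
  rw [real_inner_comm] at h4
  linarith

end QuadraticForms

section SmallRatio

variable {H : Type*} [NormedAddCommGroup H] [InnerProductSpace ℝ H]

/-- Decrease of the Lyapunov function for small `q`, as a form in position, momentum and the two
successive gradients, at the lower end of the range of `Δ₂`. Positivity of the minors is read off
from their expansions in powers of `q` and `11 - 20 * q`. -/
theorem smallRatioSlack_nonneg_of_half {q : ℝ} (hq0 : 0 < q) (hq1 : q ≤ 11 / 20)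
    (x w g G : H) :
    0 ≤ q ^ 4 / (2 * (2 + q)) * ‖x‖ ^ 2
      + 2 * (q ^ 3 * (3 + 2 * q) / (4 * (2 + q))) * ⟪x, w⟫
      + q * (8 + 32 * q + 3 * q ^ 3 + q ^ 4) / (2 * (2 + q) ^ 2) * ‖w‖ ^ 2
      + 2 * (q ^ 3 * (-6 + q) / (4 * (2 + q) * (2 - q) ^ 2)) * ⟪x, g⟫
      + 2 * (q * (32 - 328 * q + 76 * q ^ 2 - 22 * q ^ 3 - 5 * q ^ 4
        + 2 * q ^ 5) / (8 * (2 + q) ^ 3 * (2 - q) ^ 2)) * ⟪w, g⟫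
      + (448 - 288 * q + 56 * q ^ 2 - 100 * q ^ 3 + 114 * q ^ 4 - 53 * q ^ 5 - 13 * q ^ 6
        + 5 * q ^ 7) / (4 * (2 + q) ^ 4 * (2 - q) ^ 4) * ‖g‖ ^ 2
      + 2 * ((-14 + 25 * q - 12 * q ^ 2 + 2 * q ^ 3) / (2 * (2 + q) * (2 - q) ^ 3)) * ⟪g, G⟫
      + (14 - q) / (16 * (2 + q)) * ‖G‖ ^ 2 := by
  have hv : 0 ≤ 11 - 20 * q := by linarith
  have hA : 0 < 2 + q := by linarith
  have hB : 0 < 2 - q := by linarith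
  refine quadForm_four_nonneg (by positivity) ?_ (div_pos (by linarith) (by positivity)) ?_
    x w g G
  · refine lt_of_lt_of_eq (b := q ^ 5 * (32 * (11 - 20 * q) ^ 3 + 3130 * q * (11 - 20 * q) ^ 2
        + 82807 * q ^ 2 * (11 - 20 * q)
        + 649492 * q ^ 3) / (21296 * (2 + q) ^ 3)) (by positivity) ?_
    field_simp
    ring
  · refine le_of_le_of_eq (b := q ^ 10 * (258048 * (11 - 20 * q) ^ 11
        + 76150272 * q * (11 - 20 * q) ^ 10 + 9060309632 * q ^ 2 * (11 - 20 * q) ^ 9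
        + 603353910016 * q ^ 3 * (11 - 20 * q) ^ 8 + 25547427561568 * q ^ 4 * (11 - 20 * q) ^ 7
        + 730456760379456 * q ^ 5 * (11 - 20 * q) ^ 6
        + 14480589484705960 * q ^ 6 * (11 - 20 * q) ^ 5
        + 199690823799242512 * q ^ 7 * (11 - 20 * q) ^ 4
        + 1879881800786055858 * q ^ 8 * (11 - 20 * q) ^ 3
        + 11503370877434993414 * q ^ 9 * (11 - 20 * q) ^ 2
        + 41105258117713620897 * q ^ 10 * (11 - 20 * q)
        + 64728276207688280332 * q ^ 11) / (1168636602822656 * (2 + q) ^ 8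
        * (2 - q) ^ 6)) (by positivity) ?_
    field_simp
    ring

/-- The counterpart of `smallRatioSlack_nonneg_of_half` at the upper end of the range. -/
theorem smallRatioSlack_nonneg_of_one {q : ℝ} (hq0 : 0 < q) (hq1 : q ≤ 11 / 20)
    (x w g G : H) :
    0 ≤ q ^ 4 / (2 * (2 + q)) * ‖x‖ ^ 2
      + 2 * (q ^ 3 * (3 + 2 * q) / (4 * (2 + q))) * ⟪x, w⟫
      + q * (8 + 32 * q + 3 * q ^ 3 + q ^ 4) / (2 * (2 + q) ^ 2) * ‖w‖ ^ 2
      + 2 * (q ^ 2 * (-2 - 7 * q) / (4 * (2 + q) * (2 - q) ^ 2)) * ⟪x, g⟫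
      + 2 * (q ^ 2 * (-216 + 28 * q - 10 * q ^ 2
        - 7 * q ^ 3) / (4 * (2 + q) ^ 3 * (2 - q) ^ 2)) * ⟪w, g⟫
      + (896 - 448 * q + 416 * q ^ 2 - 592 * q ^ 3 - 24 * q ^ 4 - 84 * q ^ 5 - 18 * q ^ 6
        + 9 * q ^ 7) / (8 * (2 + q) ^ 4 * (2 - q) ^ 4) * ‖g‖ ^ 2
      + 2 * ((-6 + 13 * q - 6 * q ^ 2 + q ^ 3) / ((2 + q) * (2 - q) ^ 3)) * ⟪g, G⟫
      + (14 - q) / (16 * (2 + q)) * ‖G‖ ^ 2 := by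
  have hv : 0 ≤ 11 - 20 * q := by linarith
  have hA : 0 < 2 + q := by linarith
  have hB : 0 < 2 - q := by linarith
  refine quadForm_four_nonneg (by positivity) ?_ (div_pos (by linarith) (by positivity)) ?_
    x w g G
  · refine lt_of_lt_of_eq (b := q ^ 5 * (32 * (11 - 20 * q) ^ 3 + 3130 * q * (11 - 20 * q) ^ 2
        + 82807 * q ^ 2 * (11 - 20 * q)
        + 649492 * q ^ 3) / (21296 * (2 + q) ^ 3)) (by positivity) ?_
    field_simp
    ring
  · refine le_of_le_of_eq (b := q ^ 9 * (184320 * (11 - 20 * q) ^ 12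
        + 52177920 * q * (11 - 20 * q) ^ 11 + 6690286592 * q ^ 2 * (11 - 20 * q) ^ 10
        + 506398939904 * q ^ 3 * (11 - 20 * q) ^ 9 + 25045736900096 * q ^ 4 * (11 - 20 * q) ^ 8
        + 850101945877888 * q ^ 5 * (11 - 20 * q) ^ 7
        + 20247999323228160 * q ^ 6 * (11 - 20 * q) ^ 6
        + 339494742160032800 * q ^ 7 * (11 - 20 * q) ^ 5
        + 3944621987094994128 * q ^ 8 * (11 - 20 * q) ^ 4
        + 30485471913877081244 * q ^ 9 * (11 - 20 * q) ^ 3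
        + 143719111852977255364 * q ^ 10 * (11 - 20 * q) ^ 2
        + 338184591471483447067 * q ^ 11 * (11 - 20 * q)
        + 189934821532959391652 * q ^ 12) / (12855002631049216 * (2 + q) ^ 8
        * (2 - q) ^ 6)) (by positivity) ?_
    field_simp
    ring

theorem smallRatioForm_add_nonneg {q : ℝ} (hq0 : 0 < q) (hq1 : q ≤ 11 / 20)
    (x w g : H) :
    0 ≤ q ^ 2 * (1 - q) / 2 * ‖x‖ ^ 2
      + 2 * (q * (4 - q) / 4) * ⟪x, w⟫
      + (2 + 3 * q) * ‖w‖ ^ 2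
      + 2 * (q * (-1) / (2 * (2 + q))) * ⟪x, g⟫
      + 2 * ((-1) / (2 - q)) * ⟪w, g⟫
      + 41 / 80 * ‖g‖ ^ 2 := by
  have hv : 0 ≤ 11 - 20 * q := by linarith
  have hA : 0 < 2 + q := by linarith
  have hB : 0 < 2 - q := by linarith
  refine quadForm_three_nonneg ?_ ?_ (sub_nonneg.1 ?_) x w g
  · refine lt_of_lt_of_eq (b := q ^ 2 * (1 * (11 - 20 * q) + 9 * q) / 22)
      (by positivity) ?_
    field_simp
    ring
  · refine lt_of_lt_of_eq (b := q ^ 3 * (16 * (11 - 20 * q) + 45 * q) / 176)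
      (by positivity) ?_
    field_simp
    ring
  · refine le_of_le_of_eq (b := q ^ 5 * (7936 * (11 - 20 * q) ^ 6
        + 726864 * q * (11 - 20 * q) ^ 5 + 25955152 * q ^ 2 * (11 - 20 * q) ^ 4
        + 456615448 * q ^ 3 * (11 - 20 * q) ^ 3 + 4096830376 * q ^ 4 * (11 - 20 * q) ^ 2
        + 17108814709 * q ^ 5 * (11 - 20 * q)
        + 23420057805 * q ^ 6) / (4535196160 * (2 + q) ^ 2 * (2 - q) ^ 2))
      (by positivity) ?_
    field_simp
    ring

/-- The quadratic part of the Lyapunov function used when `q = √(μ / L)` is at most `11 / 20`. -/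
noncomputable def smallRatioForm (q : ℝ) (x w g : H) : ℝ :=
  q ^ 2 * (1 - q) / 2 * ‖x‖ ^ 2 + q * (4 - q) / 2 * ⟪x, w⟫ + (2 + 3 * q) * ‖w‖ ^ 2
    + ‖g‖ ^ 2 / 16 - q / (2 + q) * ⟪x, g⟫ - 2 / (2 - q) * ⟪w, g⟫

theorem smallRatioForm_lower_bound {q : ℝ} (hq0 : 0 < q) (hq1 : q ≤ 11 / 20) (x w g : H) :
    -(9 / 20) * ‖g‖ ^ 2 ≤ smallRatioForm q x w g := by
  have h := smallRatioForm_add_nonneg hq0 hq1 x w g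
  unfold smallRatioForm
  have hA : 0 < 2 + q := by linarith
  have hB : 0 < 2 - q := by linarith
  refine le_of_sub_nonneg (le_of_le_of_eq h ?_)
  field_simp
  ring

/-- One step of the scheme; the decrease is concave in `θ`, so the two end points suffice. -/
theorem smallRatio_step {q θ : ℝ} (hq0 : 0 < q) (hq1 : q ≤ 11 / 20) (hθ0 : 1 / 2 ≤ θ)
    (hθ1 : θ ≤ 1) {x w g y v G : H} {F F' : ℝ}
    (hy : y = x + w - (1 / ((2 + q) * (2 - q)) + θ / (2 - q) ^ 2) • g)
    (hv : v = ((2 - q) / (2 + q)) • w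
      + (θ / (2 - q) ^ 2
        - (2 - q) / (2 + q) * (1 / ((2 + q) * (2 - q)) + θ / (2 - q) ^ 2)) • g)
    (hx : F' + ⟪G, x - y⟫ + 1 / 2 * ‖g - G‖ ^ 2 ≤ F)
    (h0 : F' - ⟪G, y⟫ + q ^ 2 / 2 * ‖y‖ ^ 2 ≤ 0) :
    F' + smallRatioForm q y v G ≤ 2 / (2 + q) * (F + smallRatioForm q x w g) := by
  have hA : 0 < 2 + q := by linarith
  have hB : 0 < 2 - q := by linarith
  have hhalf := smallRatioSlack_nonneg_of_half hq0 hq1 x w g G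
  have hone := smallRatioSlack_nonneg_of_one hq0 hq1 x w g G
  have hcurv : 0 ≤ q ^ 2 * (4 + 18 * q - 2 * q ^ 2 - q ^ 3) / (2 * (2 + q) ^ 2)
      * ((2 * θ - 1) * (2 - 2 * θ) / (4 * (2 - q) ^ 4)) * ‖g‖ ^ 2 := by
    have e1 : 0 ≤ 4 + 18 * q - 2 * q ^ 2 - q ^ 3 := by nlinarith
    have e2 : 0 ≤ 2 * θ - 1 := by linarith
    have e3 : 0 ≤ 2 - 2 * θ := by linarith
    positivity
  have hhalf' := mul_nonneg (by linarith : 0 ≤ 2 - 2 * θ) hhalf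
  have hone' := mul_nonneg (by linarith : 0 ≤ 2 * θ - 1) hone
  have hx' := mul_nonneg (by positivity : 0 ≤ 2 / (2 + q)) (sub_nonneg.2 hx)
  have h0' := mul_nonneg (by positivity : 0 ≤ q / (2 + q)) (sub_nonneg.2 h0)
  refine le_of_sub_nonneg (le_of_le_of_eq
    (add_nonneg (add_nonneg (add_nonneg (add_nonneg hhalf' hone') hcurv) hx') h0') ?_)
  unfold smallRatioForm
  generalize he : 1 / ((2 + q) * (2 - q)) + θ / (2 - q) ^ 2 = e at hy hv
  generalize ha : (2 - q) / (2 + q) = a at hv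
  generalize hs : θ / (2 - q) ^ 2 - a * e = s at hv
  have hyy : ‖y‖ ^ 2 = ‖x‖ ^ 2 + ‖w‖ ^ 2 + e ^ 2 * ‖g‖ ^ 2 + 2 * ⟪x, w⟫ - 2 * e * ⟪x, g⟫
      - 2 * e * ⟪w, g⟫ := by
    simp only [hy, norm_sub_sq_real, norm_add_sq_real, inner_add_left, real_inner_smul_right,
      norm_smul, mul_pow, Real.norm_eq_abs, sq_abs]
    ring
  have hvv : ‖v‖ ^ 2 = a ^ 2 * ‖w‖ ^ 2 + 2 * a * s * ⟪w, g⟫ + s ^ 2 * ‖g‖ ^ 2 := by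
    simp only [hv, norm_add_sq_real, real_inner_smul_left, real_inner_smul_right,
      norm_smul, mul_pow, Real.norm_eq_abs, sq_abs]
    ring
  have hyv : ⟪y, v⟫ = a * ⟪x, w⟫ + s * ⟪x, g⟫ + a * ‖w‖ ^ 2 + (s - a * e) * ⟪w, g⟫
      - e * s * ‖g‖ ^ 2 := by
    simp only [hy, hv, inner_add_left, inner_sub_left, inner_add_right, real_inner_smul_left,
      real_inner_smul_right, real_inner_self_eq_norm_sq, real_inner_comm w g]
    ring
  have hyG : ⟪y, G⟫ = ⟪x, G⟫ + ⟪w, G⟫ - e * ⟪g, G⟫ := by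
    simp only [hy, inner_add_left, inner_sub_left, real_inner_smul_left]
  have hvG : ⟪v, G⟫ = a * ⟪w, G⟫ + s * ⟪g, G⟫ := by
    simp only [hv, inner_add_left, real_inner_smul_left]
  rw [inner_sub_right, norm_sub_sq_real, real_inner_comm x G, real_inner_comm y G, hyy, hvv, hyv,
    hyG, hvG]
  subst hs he ha
  field_simp
  ring

end SmallRatio

section LargeRatio

variable {H : Type*} [NormedAddCommGroup H] [InnerProductSpace ℝ H]

/-- Decrease of the Lyapunov function for large `q` at the lower end of the range of `Δ₂`.
Positivity of the minors is read off from their expansions in `20 * q - 11` and `1 - q`. -/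
theorem largeRatioSlack_nonneg_of_half {q : ℝ} (hq0 : 11 / 20 ≤ q) (hq1 : q < 1)
    (x u g : H) :
    0 ≤ (8 - 16 * q - 8 * q ^ 2 + 21 * q ^ 3 + 4 * q ^ 4) / (2 * (2 + q) ^ 2) * ‖x‖ ^ 2
      + 2 * ((-4 + 7 * q + 3 * q ^ 2 - 7 * q ^ 3 + q ^ 4) / (2 * (2 + q))) * ⟪x, u⟫
      + 2 * (1 - q - q ^ 2 + q ^ 3) / (2 + q) * ‖u‖ ^ 2
      + 2 * ((4 + 4 * q - 15 * q ^ 2 - 26 * q ^ 3 + 11 * q ^ 4 + 5 * q ^ 5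
        - q ^ 7) / (4 * (2 + q) ^ 2 * (2 - q) ^ 2)) * ⟪x, g⟫
      + 2 * ((-6 + 3 * q + 5 * q ^ 2 - 3 * q ^ 3 + q ^ 4) / (4 * (2 + q) * (2 - q) ^ 2)) * ⟪u, g⟫
      + (-16 + 268 * q - 256 * q ^ 2 - 73 * q ^ 3 + 144 * q ^ 4 - 19 * q ^ 5 - 16 * q ^ 6
        + 4 * q ^ 7) / (8 * (2 + q) ^ 2 * (2 - q) ^ 4) * ‖g‖ ^ 2 := by
  have hu : 0 ≤ 20 * q - 11 := by linarith
  have hv : 0 < 1 - q := by linarith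
  have hq : 0 < q := by linarith
  have hA : 0 < 2 + q := by linarith
  have hB : 0 < 2 - q := by linarith
  refine quadForm_three_nonneg ?_ ?_ (sub_nonneg.1 ?_) x u g
  · refine lt_of_lt_of_eq (b := (11376 * (1 - q) ^ 4 + 1043 * (20 * q - 11) * (1 - q) ^ 3
        + 291 * (20 * q - 11) ^ 2 * (1 - q) ^ 2 + 33 * (20 * q - 11) ^ 3 * (1 - q)
        + 1 * (20 * q - 11) ^ 4) / (1458 * (2 + q) ^ 2))
      (by positivity) ?_
    field_simp
    ring
  · refine lt_of_lt_of_eq (b := q ^ 2 * (9566383 * (1 - q) ^ 7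
        + 2724535 * (20 * q - 11) * (1 - q) ^ 6 + 321400 * (20 * q - 11) ^ 2 * (1 - q) ^ 5
        + 19652 * (20 * q - 11) ^ 3 * (1 - q) ^ 4 + 620 * (20 * q - 11) ^ 4 * (1 - q) ^ 3
        + 8 * (20 * q - 11) ^ 5 * (1 - q) ^ 2) / (78732 * (2 + q) ^ 3))
      (by positivity) ?_
    field_simp
    ring
  · refine le_of_le_of_eq (b := (53200826153255253623616 * (1 - q) ^ 21
        + 82376820968618714567588 * (20 * q - 11) * (1 - q) ^ 20
        + 48224377586673609154914 * (20 * q - 11) ^ 2 * (1 - q) ^ 19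
        + 16989157486092673379506 * (20 * q - 11) ^ 3 * (1 - q) ^ 18
        + 4315142745371030984459 * (20 * q - 11) ^ 4 * (1 - q) ^ 17
        + 855772772777085735735 * (20 * q - 11) ^ 5 * (1 - q) ^ 16
        + 136145503420326644203 * (20 * q - 11) ^ 6 * (1 - q) ^ 15
        + 17429428628332523969 * (20 * q - 11) ^ 7 * (1 - q) ^ 14
        + 1789249536566502606 * (20 * q - 11) ^ 8 * (1 - q) ^ 13
        + 146732422132935730 * (20 * q - 11) ^ 9 * (1 - q) ^ 12
        + 9577601146132012 * (20 * q - 11) ^ 10 * (1 - q) ^ 11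
        + 495062243927592 * (20 * q - 11) ^ 11 * (1 - q) ^ 10
        + 20096641452875 * (20 * q - 11) ^ 12 * (1 - q) ^ 9
        + 632017036063 * (20 * q - 11) ^ 13 * (1 - q) ^ 8
        + 15065453559 * (20 * q - 11) ^ 14 * (1 - q) ^ 7
        + 262766069 * (20 * q - 11) ^ 15 * (1 - q) ^ 6
        + 3159004 * (20 * q - 11) ^ 16 * (1 - q) ^ 5 + 23364 * (20 * q - 11) ^ 17 * (1 - q) ^ 4
        + 80 * (20 * q - 11) ^ 18 * (1 - q) ^ 3) / (118593292086517824 * (2 + q) ^ 7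
        * (2 - q) ^ 4))
      (by positivity) ?_
    field_simp
    ring

/-- The counterpart of `largeRatioSlack_nonneg_of_half` at the upper end of the range. -/
theorem largeRatioSlack_nonneg_of_one {q : ℝ} (hq0 : 11 / 20 ≤ q) (hq1 : q < 1)
    (x u g : H) :
    0 ≤ (8 - 16 * q - 8 * q ^ 2 + 21 * q ^ 3 + 4 * q ^ 4) / (2 * (2 + q) ^ 2) * ‖x‖ ^ 2
      + 2 * ((-4 + 7 * q + 3 * q ^ 2 - 7 * q ^ 3 + q ^ 4) / (2 * (2 + q))) * ⟪x, u⟫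
      + 2 * (1 - q - q ^ 2 + q ^ 3) / (2 + q) * ‖u‖ ^ 2
      + 2 * (q * (8 - 8 * q - 30 * q ^ 2 + 8 * q ^ 3 + 5 * q ^ 4
        - q ^ 6) / (4 * (2 + q) ^ 2 * (2 - q) ^ 2)) * ⟪x, g⟫
      + 2 * ((-2 + q + q ^ 2 - q ^ 3 + q ^ 4) / (2 * (2 + q) * (2 - q) ^ 2)) * ⟪u, g⟫
      + q * (60 - 72 * q - 11 * q ^ 2 + 40 * q ^ 3 - 5 * q ^ 4 - 4 * q ^ 5
        + q ^ 6) / (2 * (2 + q) ^ 2 * (2 - q) ^ 4) * ‖g‖ ^ 2 := by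
  have hu : 0 ≤ 20 * q - 11 := by linarith
  have hv : 0 < 1 - q := by linarith
  have hq : 0 < q := by linarith
  have hA : 0 < 2 + q := by linarith
  have hB : 0 < 2 - q := by linarith
  refine quadForm_three_nonneg ?_ ?_ (sub_nonneg.1 ?_) x u g
  · refine lt_of_lt_of_eq (b := (11376 * (1 - q) ^ 4 + 1043 * (20 * q - 11) * (1 - q) ^ 3
        + 291 * (20 * q - 11) ^ 2 * (1 - q) ^ 2 + 33 * (20 * q - 11) ^ 3 * (1 - q)
        + 1 * (20 * q - 11) ^ 4) / (1458 * (2 + q) ^ 2))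
      (by positivity) ?_
    field_simp
    ring
  · refine lt_of_lt_of_eq (b := q ^ 2 * (9566383 * (1 - q) ^ 7
        + 2724535 * (20 * q - 11) * (1 - q) ^ 6 + 321400 * (20 * q - 11) ^ 2 * (1 - q) ^ 5
        + 19652 * (20 * q - 11) ^ 3 * (1 - q) ^ 4 + 620 * (20 * q - 11) ^ 4 * (1 - q) ^ 3
        + 8 * (20 * q - 11) ^ 5 * (1 - q) ^ 2) / (78732 * (2 + q) ^ 3))
      (by positivity) ?_
    field_simp
    ring
  · refine le_of_le_of_eq (b := (27751414246765354648944 * (1 - q) ^ 21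
        + 31268804013487598260099 * (20 * q - 11) * (1 - q) ^ 20
        + 15862637049606448646261 * (20 * q - 11) ^ 2 * (1 - q) ^ 19
        + 5131490403318342855888 * (20 * q - 11) ^ 3 * (1 - q) ^ 18
        + 1225941249241585870156 * (20 * q - 11) ^ 4 * (1 - q) ^ 17
        + 230742635668827899837 * (20 * q - 11) ^ 5 * (1 - q) ^ 16
        + 34893046451086358397 * (20 * q - 11) ^ 6 * (1 - q) ^ 15
        + 4237962987124786510 * (20 * q - 11) ^ 7 * (1 - q) ^ 14
        + 411179575612143404 * (20 * q - 11) ^ 8 * (1 - q) ^ 13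
        + 31692726095516613 * (20 * q - 11) ^ 9 * (1 - q) ^ 12
        + 1929135964323767 * (20 * q - 11) ^ 10 * (1 - q) ^ 11
        + 91969593006676 * (20 * q - 11) ^ 11 * (1 - q) ^ 10
        + 3389542943460 * (20 * q - 11) ^ 12 * (1 - q) ^ 9
        + 94568334371 * (20 * q - 11) ^ 13 * (1 - q) ^ 8
        + 1930180279 * (20 * q - 11) ^ 14 * (1 - q) ^ 7
        + 27180462 * (20 * q - 11) ^ 15 * (1 - q) ^ 6
        + 235988 * (20 * q - 11) ^ 16 * (1 - q) ^ 5
        + 952 * (20 * q - 11) ^ 17 * (1 - q) ^ 4) / (29648323021629456 * (2 + q) ^ 7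
        * (2 - q) ^ 4))
      (by positivity) ?_
    field_simp
    ring

/-- The Lyapunov function used when `q = √(μ / L)` is at least `11 / 20`. -/
noncomputable def largeRatioForm (q : ℝ) (x u : H) : ℝ :=
  ‖x‖ ^ 2 - (3 - q) * ⟪x, u⟫ + (2 - q / 2) * ‖u‖ ^ 2

theorem largeRatioForm_lower_bound {q : ℝ} (hq0 : 11 / 20 ≤ q) (hq1 : q < 1) (x u : H) :
    1 / 16 * ‖x‖ ^ 2 ≤ largeRatioForm q x u := by
  have h := quadForm_two_nonneg (a := 15 / 16) (b := -(3 - q) / 2) (c := 2 - q / 2) (by norm_num)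
    (by nlinarith) x u
  unfold largeRatioForm
  linarith

/-- One step of the scheme; the decrease is concave in `θ`, so the two end points suffice. -/
theorem largeRatio_step {q θ : ℝ} (hq0 : 11 / 20 ≤ q) (hq1 : q < 1) (hθ0 : 1 / 2 ≤ θ)
    (hθ1 : θ ≤ 1) {x u g y v : H}
    (hy : y = (1 + (2 - q) / (2 + q)) • x - u
      - (1 / ((2 + q) * (2 - q)) + θ / (2 - q) ^ 2) • g)
    (hv : v = ((2 - q) / (2 + q)) • x - (θ / (2 - q) ^ 2) • g)
    (hsec : 0 ≤ ⟪g - q ^ 2 • x, x - g⟫) :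
    largeRatioForm q y v ≤ 2 / (2 + q) * largeRatioForm q x u := by
  have hA : 0 < 2 + q := by linarith
  have hB : 0 < 2 - q := by linarith
  have hD : 0 < 1 - q ^ 2 := by nlinarith
  have hhalf := mul_nonneg (by linarith : 0 ≤ 2 - 2 * θ)
    (largeRatioSlack_nonneg_of_half hq0 hq1 x u g)
  have hone := mul_nonneg (by linarith : 0 ≤ 2 * θ - 1)
    (largeRatioSlack_nonneg_of_one hq0 hq1 x u g)
  have hcurv : 0 ≤ (1 - q ^ 2) * (q / 2)
      * ((2 * θ - 1) * (2 - 2 * θ) / (4 * (2 - q) ^ 4)) * ‖g‖ ^ 2 := by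
    have e2 : 0 ≤ 2 * θ - 1 := by linarith
    have e3 : 0 ≤ 2 - 2 * θ := by linarith
    have e4 : 0 ≤ q := by linarith
    positivity
  have hsec' := mul_nonneg (by linarith : 0 ≤ q / 2) hsec
  refine le_of_mul_le_mul_left (le_of_sub_nonneg (le_of_le_of_eq
    (add_nonneg (add_nonneg (add_nonneg hhalf hone) hcurv) hsec') ?_)) hD
  unfold largeRatioForm
  generalize he : 1 / ((2 + q) * (2 - q)) + θ / (2 - q) ^ 2 = e at hy
  generalize ha : (2 - q) / (2 + q) = a at hy hv
  generalize hc : θ / (2 - q) ^ 2 = c at he hv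
  have hyy : ‖y‖ ^ 2 = (1 + a) ^ 2 * ‖x‖ ^ 2 + ‖u‖ ^ 2 + e ^ 2 * ‖g‖ ^ 2 - 2 * (1 + a) * ⟪x, u⟫
      - 2 * (1 + a) * e * ⟪x, g⟫ + 2 * e * ⟪u, g⟫ := by
    simp only [hy, norm_sub_sq_real, inner_sub_left, real_inner_smul_left, real_inner_smul_right,
      norm_smul, mul_pow, Real.norm_eq_abs, sq_abs]
    ring
  have hvv : ‖v‖ ^ 2 = a ^ 2 * ‖x‖ ^ 2 - 2 * a * c * ⟪x, g⟫ + c ^ 2 * ‖g‖ ^ 2 := by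
    simp only [hv, norm_sub_sq_real, real_inner_smul_left, real_inner_smul_right,
      norm_smul, mul_pow, Real.norm_eq_abs, sq_abs]
    ring
  have hyv : ⟪y, v⟫ = (1 + a) * a * ‖x‖ ^ 2 - ((1 + a) * c + a * e) * ⟪x, g⟫ - a * ⟪x, u⟫
      + c * ⟪u, g⟫ + e * c * ‖g‖ ^ 2 := by
    simp only [hy, hv, inner_sub_left, inner_sub_right, real_inner_smul_left,
      real_inner_smul_right, real_inner_self_eq_norm_sq, real_inner_comm x g, real_inner_comm x u]
    ring
  have hsecx : ⟪g - q ^ 2 • x, x - g⟫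
      = (1 + q ^ 2) * ⟪x, g⟫ - q ^ 2 * ‖x‖ ^ 2 - ‖g‖ ^ 2 := by
    simp only [inner_sub_left, inner_sub_right, real_inner_smul_left,
      real_inner_self_eq_norm_sq, real_inner_comm x g]
    ring
  rw [hyy, hvv, hyv, hsecx]
  subst he hc ha
  field_simp
  ring

end LargeRatio

section Rate

variable {H : Type*} [NormedAddCommGroup H] [InnerProductSpace ℝ H]

/-- The scheme for the normalised objective `φ` (smoothness constant `1`, strong convexity constant
`q ^ 2`, minimum `0` attained at `0`) with gradient `p` converges at rate `(1 + q / 2)⁻¹`. -/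
theorem normalized_scheme_rate {φ : H → ℝ} {p : H → H} {q θ : ℝ} (hq0 : 0 < q) (hq1 : q < 1)
    (hθ0 : 1 / 2 ≤ θ) (hθ1 : θ ≤ 1)
    (hlow : ∀ x y, φ x + ⟪p x, y - x⟫ + q ^ 2 / 2 * ‖y - x‖ ^ 2 ≤ φ y)
    (hupp : ∀ x y, φ y ≤ φ x + ⟪p x, y - x⟫ + 1 / 2 * ‖y - x‖ ^ 2)
    (hφ : φ 0 = 0) (hp : p 0 = 0) {x : ℕ → H}
    (hrec : ∀ k, x (k + 2) = x (k + 1) + ((2 - q) / (2 + q)) • (x (k + 1) - x k)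
      - (1 / ((2 + q) * (2 - q))) • p (x (k + 1))
      - (θ / (2 - q) ^ 2) • (p (x (k + 1)) - p (x k))) :
    ∃ C, 0 ≤ C ∧ ∀ k, φ (x k) ≤ C * (2 / (2 + q)) ^ k := by
  have geometric : ∀ V : ℕ → ℝ, (∀ k, V (k + 1) ≤ 2 / (2 + q) * V k) →
      ∀ k, V k ≤ V 0 * (2 / (2 + q)) ^ k := by
    intro V hV k
    induction k with
    | zero => simp
    | succ k ih =>
      calc V (k + 1) ≤ 2 / (2 + q) * V k := hV k
        _ ≤ 2 / (2 + q) * (V 0 * (2 / (2 + q)) ^ k) := by gcongr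
        _ = V 0 * (2 / (2 + q)) ^ (k + 1) := by ring
  rcases le_total q (11 / 20) with hq | hq
  · have hco := tangent_add_norm_sq_le_of_bounds one_pos
      (fun x y => le_trans (le_add_of_nonneg_right (by positivity)) (hlow x y)) hupp
    have hgrad : ∀ z, 1 / 2 * ‖p z‖ ^ 2 ≤ φ z := fun z => by
      simpa [hφ, hp] using hco z 0
    set e := 1 / ((2 + q) * (2 - q)) + θ / (2 - q) ^ 2 with he
    set V : ℕ → ℝ := fun k =>
      φ (x k) + smallRatioForm q (x k) (x (k + 1) - x k + e • p (x k)) (p (x k)) with hVdef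
    have hlb : ∀ k, 1 / 10 * φ (x k) ≤ V k := fun k => by
      have h1 := smallRatioForm_lower_bound hq0 hq (x k) (x (k + 1) - x k + e • p (x k)) (p (x k))
      have h2 := hgrad (x k)
      simp only [hVdef]
      linarith
    have hV := geometric V fun k => by
      refine smallRatio_step (θ := θ) hq0 hq hθ0 hθ1 (by rw [← he]; abel) ?_ ?_ ?_
      · rw [← he, hrec k, he]
        module
      · simpa using hco (x k) (x (k + 1))
      · have h := hlow (x (k + 1)) 0
        rw [zero_sub, inner_neg_right, norm_neg, hφ] at h
        linarith
    refine ⟨10 * V 0, ?_, fun k => ?_⟩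
    · have h1 := hlb 0
      have h2 := hgrad (x 0)
      nlinarith [sq_nonneg ‖p (x 0)‖]
    · linarith [hlb k, hV k]
  · set u : ℕ → H := fun k => (1 + (2 - q) / (2 + q)) • x k
      - (1 / ((2 + q) * (2 - q)) + θ / (2 - q) ^ 2) • p (x k) - x (k + 1) with hu
    have hlb : ∀ k, 1 / 16 * ‖x k‖ ^ 2 ≤ largeRatioForm q (x k) (u k) := fun k =>
      largeRatioForm_lower_bound hq hq1 _ _
    have hV := geometric (fun k => largeRatioForm q (x k) (u k)) fun k => by
      refine largeRatio_step (θ := θ) (g := p (x k)) hq hq1 hθ0 hθ1 ?_ ?_ ?_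
      · simp only [hu]
        abel
      · simp only [hu]
        rw [hrec k]
        module
      · exact sector_of_bounds (by nlinarith) hlow hupp hp (x k)
    refine ⟨8 * largeRatioForm q (x 0) (u 0), ?_, fun k => ?_⟩
    · nlinarith [hlb 0, sq_nonneg ‖x 0‖]
    · have h := hupp 0 (x k)
      rw [hφ, hp, inner_zero_left, sub_zero] at h
      linarith [hlb k, hV k]

end Rate

/-- Algorithm 2 (modified-symplectic-derived scheme with `s = 1/(4L)`,
`Δ₁ = √μ/(2√L − √μ)`, and `1/(2(2√L − √μ)) ≤ Δ₂ ≤ 1/(2√L − √μ)`) achieves the rate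
`O((1 + (1/2)√(μ/L))^{−k})`. -/
theorem modified_symplectic_algorithm_accelerated_rate
    {H : Type*} [NormedAddCommGroup H] [InnerProductSpace ℝ H] [CompleteSpace H]
    (f : H → ℝ) (μ L : ℝ) (hμ : 0 < μ) (hμL : μ < L)
    (hf : ContDiff ℝ 1 f) (hsc : StrongConvexOn Set.univ μ f)
    (hL : ∀ x y, ‖gradient f x - gradient f y‖ ≤ L * ‖x - y‖)
    (xs : H) (hmin : ∀ y, f xs ≤ f y)
    (Δ₂ : ℝ)
    (hΔ₂ : 1 / (2 * (2 * Real.sqrt L - Real.sqrt μ)) ≤ Δ₂)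
    (hΔ₂' : Δ₂ ≤ 1 / (2 * Real.sqrt L - Real.sqrt μ))
    (x : ℕ → H) (hinit : x 1 = x 0)
    (hrec : ∀ k, x (k + 2) = x (k + 1)
      + ((2 * Real.sqrt L - Real.sqrt μ) / (2 * Real.sqrt L + Real.sqrt μ)) •
          (x (k + 1) - x k)
      - (1 / (4 * L - μ)) • gradient f (x (k + 1))
      - (Δ₂ / (2 * Real.sqrt L - Real.sqrt μ)) •
          (gradient f (x (k + 1)) - gradient f (x k))) :
    ∃ C, 0 ≤ C ∧ ∀ k,
      f (x k) - f xs ≤ C * ((1 + 1 / 2 * Real.sqrt (μ / L)) ^ k)⁻¹ := by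
  have hL0 : 0 < L := hμ.trans hμL
  have hd : Differentiable ℝ f := hf.differentiable one_ne_zero
  have hgrad : gradient f xs = 0 := by
    have hmin' : IsLocalMin f xs := Filter.Eventually.of_forall hmin
    rw [gradient, hmin'.fderiv_eq_zero, map_zero]
  obtain ⟨q, hq⟩ : ∃ q, q = √(μ / L) := ⟨_, rfl⟩
  have hq0 : 0 < q := by rw [hq]; positivity
  have hq2 : q ^ 2 = μ / L := by rw [hq, Real.sq_sqrt (by positivity)]
  have hq1 : q < 1 := by
    have h : q ^ 2 < 1 := by rw [hq2, div_lt_one hL0]; exact hμL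
    nlinarith
  have hμq : μ = q ^ 2 * L := by rw [hq2]; field_simp
  have hsL : 0 < √L := Real.sqrt_pos.2 hL0
  have hsμ : √μ = q * √L := by
    rw [hμq, Real.sqrt_mul (sq_nonneg q), Real.sqrt_sq hq0.le]
  have hsqL : √L ^ 2 = L := Real.sq_sqrt hL0.le
  have hB : 0 < 2 - q := by linarith
  have hdiff : 2 * √L - √μ = √L * (2 - q) := by rw [hsμ]; ring
  have hsum : 2 * √L + √μ = √L * (2 + q) := by rw [hsμ]; ring
  rw [hdiff] at hΔ₂ hΔ₂'
  have c1 : (2 * √L - √μ) / (2 * √L + √μ) = (2 - q) / (2 + q) := by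
    rw [hdiff, hsum, mul_div_mul_left _ _ hsL.ne']
  have c2 : 1 / (4 * L - μ) = 1 / ((2 + q) * (2 - q)) * L⁻¹ := by
    rw [hμq, show 4 * L - q ^ 2 * L = (2 + q) * (2 - q) * L by ring, one_div, mul_inv, one_div]
  have c3 : Δ₂ / (2 * √L - √μ) = Δ₂ * (√L * (2 - q)) / (2 - q) ^ 2 * L⁻¹ := by
    rw [hdiff]
    field_simp
    rw [hsqL]
  obtain ⟨C, hC, hrate⟩ := normalized_scheme_rate (φ := fun z => L⁻¹ * (f (xs + z) - f xs))
    (p := fun z => L⁻¹ • gradient f (xs + z)) (θ := Δ₂ * (√L * (2 - q)))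
    (x := fun k => x k - xs) hq0 hq1
    (by
      rw [div_le_iff₀ (by positivity)] at hΔ₂
      linarith)
    (by rwa [le_div_iff₀ (by positivity)] at hΔ₂')
    (fun a b => by
      have h := mul_le_mul_of_nonneg_left
        (strongConvexOn_gradient_lower_bound hd hsc (xs + a) (xs + b)) (inv_pos.2 hL0).le
      rw [add_sub_add_left_eq_sub] at h
      rw [real_inner_smul_left, hq2, div_eq_mul_inv μ L]
      linarith)
    (fun a b => by
      have h := mul_le_mul_of_nonneg_left
        (gradient_lipschitz_upper_bound hd hL (xs + a) (xs + b)) (inv_pos.2 hL0).le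
      rw [add_sub_add_left_eq_sub] at h
      rw [real_inner_smul_left]
      have e : L⁻¹ * (L / 2 * ‖b - a‖ ^ 2) = 1 / 2 * ‖b - a‖ ^ 2 := by field_simp
      linarith)
    (by simp) (by simp [hgrad])
    (fun k => by
      simp only [add_sub_cancel]
      rw [hrec k, c1, c2, c3]
      module)
  refine ⟨L * C, by positivity, fun k => ?_⟩
  have h := mul_le_mul_of_nonneg_left (hrate k) hL0.le
  simp only [add_sub_cancel, mul_inv_cancel_left₀ hL0.ne'] at h
  have e : (2 / (2 + q)) ^ k = ((1 + 1 / 2 * √(μ / L)) ^ k)⁻¹ := by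
    rw [← hq, ← inv_pow]
    congr 1
    field_simp
  rwa [e, ← mul_assoc] at h
end

section
/- For the quadratic function f(x) = (1/2)⟨x, Ax⟩ on ℝ² with A = Diag(μ, L), the unperturbed symplectic-Euler scheme (Δ₁ = Δ₂ = 0) with step size s = 1/L, i.e. x_{k+1} = x_k + (1/(1+2√(μ/L)))(x_k − x_{k−1}) − (1/((1+2√(μ/L))L))∇f(x_k), satisfies: for any initial points x₀, x₁, there exists C ≥ 0 such that f(x_k) ≤ C·(1/(1+2√(μ/L)))^k for all k ≥ 0. -/
/-- A second-order linear recurrence with complex-conjugate characteristic roots of modulus `√b`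
has squares of order `b ^ k`. -/
theorem exists_sq_le_mul_pow_of_linear_recurrence {p b : ℝ} (hpb : p ^ 2 < 4 * b) (u : ℕ → ℝ)
    (hu : ∀ k, u (k + 2) = p * u (k + 1) - b * u k) :
    ∃ C, 0 ≤ C ∧ ∀ k, u k ^ 2 ≤ C * b ^ k := by
  have hV : ∀ k, u (k + 1) ^ 2 - p * u (k + 1) * u k + b * u k ^ 2
      = (u 1 ^ 2 - p * u 1 * u 0 + b * u 0 ^ 2) * b ^ k := by
    intro k
    induction k with
    | zero => simp
    | succ k ih =>
      rw [pow_succ b, ← mul_assoc, ← ih, hu k]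
      ring
  have hd : 0 < b - p ^ 2 / 4 := by linarith
  refine ⟨(u 1 ^ 2 - p * u 1 * u 0 + b * u 0 ^ 2) / (b - p ^ 2 / 4),
    div_nonneg ?_ hd.le, fun k => ?_⟩
  · nlinarith [sq_nonneg (u 1 - p / 2 * u 0), mul_nonneg hd.le (sq_nonneg (u 0))]
  · rw [div_mul_eq_mul_div, le_div_iff₀ hd, ← hV k]
    nlinarith [sq_nonneg (u (k + 1) - p / 2 * u k)]


/-- unperturbed symplectic Euler scheme (`Δ₁ = Δ₂ = 0`, `s = 1/L`) on the
quadratic `f(x) = (1/2)⟨x, Ax⟩`, `A = Diag(μ, L)`: rate `O((1/(1+2√(μ/L)))^k)`. -/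
theorem symplectic_quadratic_unperturbed_rate
    (μ L : ℝ) (hμ : 0 < μ) (hμL : μ < L)
    (A : (Fin 2 → ℝ) → Fin 2 → ℝ)
    (hA : ∀ y i, A y i = (if i = 0 then μ else L) * y i)
    (f : (Fin 2 → ℝ) → ℝ)
    (hf : ∀ y, f y = 1 / 2 * (μ * y 0 ^ 2 + L * y 1 ^ 2))
    (x : ℕ → Fin 2 → ℝ)
    (hrec : ∀ k, x (k + 2) = x (k + 1)
      + (1 / (1 + 2 * Real.sqrt (μ / L))) • (x (k + 1) - x k)
      - (1 / ((1 + 2 * Real.sqrt (μ / L)) * L)) • A (x (k + 1))) :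
    ∃ C, 0 ≤ C ∧ ∀ k, f (x k) ≤ C * (1 / (1 + 2 * Real.sqrt (μ / L))) ^ k := by
  have hL : 0 < L := hμ.trans hμL
  set q := Real.sqrt (μ / L) with hq
  have hq0 : 0 < q := Real.sqrt_pos.2 (div_pos hμ hL)
  have hqq : q ^ 2 = μ / L := Real.sq_sqrt (div_pos hμ hL).le
  have hq1 : q < 1 := by
    rw [hq, Real.sqrt_lt' one_pos, one_pow, div_lt_one hL]
    exact hμL
  set b := 1 / (1 + 2 * q) with hb
  have hb0 : 0 < b := by positivity
  have hbq : b * (1 + 2 * q) = 1 := by rw [hb]; field_simp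
  have hbL : 1 / ((1 + 2 * q) * L) = b / L := by rw [hb]; field_simp
  rw [hbL] at hrec
  obtain ⟨C₀, hC₀, h₀⟩ := exists_sq_le_mul_pow_of_linear_recurrence
    (p := 1 + b - b * q ^ 2) (b := b) (by
      have hp : 1 + b - b * q ^ 2 = b * (2 + 2 * q - q ^ 2) := by linear_combination -hbq
      have h4 : 4 * b = b ^ 2 * (4 * (1 + 2 * q)) := by linear_combination -4 * b * hbq
      rw [hp, mul_pow, h4]
      refine mul_lt_mul_of_pos_left ?_ (by positivity)
      nlinarith [mul_pos (pow_pos hq0 3) (by linarith : 0 < 4 - q)]) (fun k => x k 0) (by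
      intro k
      have h := congrFun (hrec k) 0
      simp only [Pi.sub_apply, Pi.add_apply, Pi.smul_apply, smul_eq_mul, hA, if_true] at h
      rw [h, hqq]
      ring)
  obtain ⟨C₁, hC₁, h₁⟩ := exists_sq_le_mul_pow_of_linear_recurrence
    (p := 1) (b := b) (by nlinarith) (fun k => x k 1) (by
      intro k
      have h := congrFun (hrec k) 1
      simp only [Pi.sub_apply, Pi.add_apply, Pi.smul_apply, smul_eq_mul, hA, one_ne_zero,
        if_false] at h
      rw [h]
      field_simp
      ring)
  refine ⟨1 / 2 * (μ * C₀ + L * C₁), by positivity, fun k => ?_⟩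
  rw [hf]
  linarith [mul_le_mul_of_nonneg_left (h₀ k) hμ.le, mul_le_mul_of_nonneg_left (h₁ k) hL.le]
end

section
/- For the quadratic function f(x) = (1/2)⟨x, Ax⟩ on ℝ² with A = Diag(μ, L), the symplectic-Euler scheme with step size s = 1/L, Δ₁ = 0 and Δ₂ = 1/√L, i.e. x_{k+1} = x_k + (1/(1+2√(μ/L)))(x_k − x_{k−1}) − (1/((1+2√(μ/L))L))∇f(x_k) − (1/((1+2√(μ/L))L))(∇f(x_k) − ∇f(x_{k−1})), satisfies: for any initial points x₀, x₁, there exists C ≥ 0 such that f(x_k) ≤ C·((1+√(μ/L))/(1+2√(μ/L)))^{2k} for all k ≥ 0. -/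
/-- A solution of a second-order linear recurrence whose characteristic roots are `0 ≤ s < r`
is `O(r ^ k)`. -/
theorem exists_abs_le_mul_pow_of_linear_recurrence {u : ℕ → ℝ} {r s : ℝ} (hs : 0 ≤ s)
    (hsr : s < r) (hu : ∀ k, u (k + 2) = (r + s) * u (k + 1) - r * s * u k) :
    ∃ M, 0 ≤ M ∧ ∀ k, |u k| ≤ M * r ^ k := by
  have hr : ∀ k, u (k + 1) - s * u k = r ^ k * (u 1 - s * u 0) := by
    intro k
    induction k with
    | zero => simp
    | succ k ih => rw [hu, pow_succ]; linear_combination r * ih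
  have hs' : ∀ k, u (k + 1) - r * u k = s ^ k * (u 1 - r * u 0) := by
    intro k
    induction k with
    | zero => simp
    | succ k ih => rw [hu, pow_succ]; linear_combination s * ih
  have hd : 0 < r - s := sub_pos.2 hsr
  refine ⟨(|u 1 - s * u 0| + |u 1 - r * u 0|) / (r - s), by positivity, fun k => ?_⟩
  have hk : u k * (r - s) = r ^ k * (u 1 - s * u 0) - s ^ k * (u 1 - r * u 0) := by
    linear_combination hr k - hs' k
  rw [div_mul_eq_mul_div, le_div_iff₀ hd]
  calc |u k| * (r - s) = |u k * (r - s)| := by rw [abs_mul, abs_of_pos hd]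
    _ ≤ |r ^ k * (u 1 - s * u 0)| + |s ^ k * (u 1 - r * u 0)| := by rw [hk]; exact abs_sub _ _
    _ = r ^ k * |u 1 - s * u 0| + s ^ k * |u 1 - r * u 0| := by
      rw [abs_mul, abs_mul, abs_of_nonneg (pow_nonneg (hs.trans hsr.le) k),
        abs_of_nonneg (pow_nonneg hs k)]
    _ ≤ r ^ k * |u 1 - s * u 0| + r ^ k * |u 1 - r * u 0| := by gcongr
    _ = (|u 1 - s * u 0| + |u 1 - r * u 0|) * r ^ k := by ring

/-- symplectic Euler scheme with `s = 1/L`, `Δ₁ = 0`, `Δ₂ = 1/√L` on the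
quadratic `f(x) = (1/2)⟨x, Ax⟩`, `A = Diag(μ, L)`: rate `O(((1+√(μ/L))/(1+2√(μ/L)))^{2k})`. -/
theorem symplectic_quadratic_gradient_correction_only_rate
    (μ L : ℝ) (hμ : 0 < μ) (hμL : μ < L)
    (A : (Fin 2 → ℝ) → Fin 2 → ℝ)
    (hA : ∀ y i, A y i = (if i = 0 then μ else L) * y i)
    (f : (Fin 2 → ℝ) → ℝ)
    (hf : ∀ y, f y = 1 / 2 * (μ * y 0 ^ 2 + L * y 1 ^ 2))
    (x : ℕ → Fin 2 → ℝ)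
    (hrec : ∀ k, x (k + 2) = x (k + 1)
      + (1 / (1 + 2 * Real.sqrt (μ / L))) • (x (k + 1) - x k)
      - (1 / ((1 + 2 * Real.sqrt (μ / L)) * L)) • A (x (k + 1))
      - (1 / ((1 + 2 * Real.sqrt (μ / L)) * L)) • (A (x (k + 1)) - A (x k))) :
    ∃ C, 0 ≤ C ∧ ∀ k,
      f (x k) ≤ C * ((1 + Real.sqrt (μ / L)) / (1 + 2 * Real.sqrt (μ / L))) ^ (2 * k) := by
  have hL : 0 < L := hμ.trans hμL
  set q := Real.sqrt (μ / L) with hq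
  have hq0 : 0 < q := Real.sqrt_pos.2 (div_pos hμ hL)
  have hqq : q ^ 2 = μ / L := Real.sq_sqrt (div_pos hμ hL).le
  have hμq : μ = q ^ 2 * L := by rw [hqq, div_mul_cancel₀ _ hL.ne']
  have hq1 : q < 1 := by
    have : q ^ 2 < 1 := hqq ▸ (div_lt_one hL).2 hμL
    nlinarith
  have hD : 0 < 1 + 2 * q := by positivity
  obtain ⟨M, hM, hxM⟩ := exists_abs_le_mul_pow_of_linear_recurrence (u := fun k => x k 0)
    (r := (1 + q) / (1 + 2 * q)) (s := 1 - q) (by linarith)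
    (by rw [lt_div_iff₀ hD]; nlinarith) (fun k => by
      have h := congrFun (hrec k) 0
      simp only [Pi.add_apply, Pi.sub_apply, Pi.smul_apply, smul_eq_mul, hA, if_true] at h
      rw [h, hμq]
      field_simp
      ring)
  obtain ⟨N, hN, hxN⟩ := exists_abs_le_mul_pow_of_linear_recurrence (u := fun k => x k 1)
    (r := 2 * q / (1 + 2 * q)) (s := 0) le_rfl (by positivity) (fun k => by
      have h := congrFun (hrec k) 1
      simp only [Pi.add_apply, Pi.sub_apply, Pi.smul_apply, smul_eq_mul, hA, one_ne_zero,
        if_false] at h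
      rw [h]
      field_simp
      ring)
  refine ⟨1 / 2 * (μ * M ^ 2 + L * N ^ 2), by positivity, fun k => ?_⟩
  have h0 : x k 0 ^ 2 ≤ (M * ((1 + q) / (1 + 2 * q)) ^ k) ^ 2 :=
    sq_le_sq' (abs_le.1 (hxM k)).1 (abs_le.1 (hxM k)).2
  have hN' : |x k 1| ≤ N * ((1 + q) / (1 + 2 * q)) ^ k := by
    refine (hxN k).trans ?_
    gcongr
    linarith
  have h1 : x k 1 ^ 2 ≤ (N * ((1 + q) / (1 + 2 * q)) ^ k) ^ 2 :=
    sq_le_sq' (abs_le.1 hN').1 (abs_le.1 hN').2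
  calc f (x k) = 1 / 2 * (μ * x k 0 ^ 2 + L * x k 1 ^ 2) := hf _
    _ ≤ 1 / 2 * (μ * (M * ((1 + q) / (1 + 2 * q)) ^ k) ^ 2
        + L * (N * ((1 + q) / (1 + 2 * q)) ^ k) ^ 2) := by gcongr
    _ = 1 / 2 * (μ * M ^ 2 + L * N ^ 2) * ((1 + q) / (1 + 2 * q)) ^ (2 * k) := by ring
end

section
/- For the quadratic function f(x) = (1/2)⟨x, Ax⟩ on ℝ² with A = Diag(μ, L), the symplectic-Euler scheme with step size s = 1/L, Δ₁ = √(μ/L) and Δ₂ = 1/√L, i.e. x_{k+1} = x_k + (1/(1+2√(μ/L)))(x_k − x_{k−1}) − ((1+√(μ/L))/((1+2√(μ/L))L))∇f(x_k) − (1/((1+2√(μ/L))L))(∇f(x_k) − ∇f(x_{k−1})), satisfies: for any initial points x₀, x₁, there exists C ≥ 0 such that f(x_k) ≤ C·((1 + 2√(μ/L) − 3μ²/(4L²))/(1+2√(μ/L))²)^k for all k ≥ 0. -/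
/-- Jury-type criterion: a second-order linear recurrence whose characteristic roots have modulus
less than `√r` decays like `√r ^ k`. -/
theorem exists_sq_le_mul_pow_of_linear_recurrence_s19 {p d r : ℝ} (hdr : d < r) (hrd : 0 < r + d)
    (hp : p ^ 2 * r < (r + d) ^ 2) (a : ℕ → ℝ)
    (ha : ∀ k, a (k + 2) = p * a (k + 1) - d * a k) :
    ∃ C, 0 ≤ C ∧ ∀ k, a k ^ 2 ≤ C * r ^ k := by
  have hr : 0 < r := by linarith
  set V : ℕ → ℝ := fun k =>
    (r + d) * (a (k + 1) ^ 2 + r * a k ^ 2) - 2 * p * r * a k * a (k + 1) with hV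
  have hstep : ∀ k, V (k + 1) ≤ r * V k := by
    intro k
    have h : V (k + 1) - r * V k = -((r - d) * (a (k + 2) - r * a k) ^ 2) := by
      simp only [hV, show k + 1 + 1 = k + 2 from rfl, ha]
      ring
    have := mul_nonneg (sub_nonneg.2 hdr.le) (sq_nonneg (a (k + 2) - r * a k))
    linarith
  have hVpow : ∀ k, V k ≤ V 0 * r ^ k := by
    intro k
    induction k with
    | zero => simp
    | succ k ih =>
      calc V (k + 1) ≤ r * V k := hstep k
        _ ≤ r * (V 0 * r ^ k) := by gcongr
        _ = V 0 * r ^ (k + 1) := by ring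
  set e : ℝ := r * ((r + d) ^ 2 - p ^ 2 * r) with he
  have hepos : 0 < e := mul_pos hr (sub_pos.2 hp)
  have hlow : ∀ k, e * a k ^ 2 ≤ (r + d) * V k := by
    intro k
    have h : (r + d) * V k - e * a k ^ 2 = ((r + d) * a (k + 1) - p * r * a k) ^ 2 := by
      simp only [hV, he]
      ring
    have := sq_nonneg ((r + d) * a (k + 1) - p * r * a k)
    linarith
  have hbound : ∀ k, a k ^ 2 ≤ (r + d) * V 0 / e * r ^ k := by
    intro k
    rw [div_mul_eq_mul_div, le_div_iff₀ hepos]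
    calc a k ^ 2 * e = e * a k ^ 2 := mul_comm _ _
      _ ≤ (r + d) * V k := hlow k
      _ ≤ (r + d) * (V 0 * r ^ k) := by gcongr; exact hVpow k
      _ = (r + d) * V 0 * r ^ k := by ring
  refine ⟨_, ?_, hbound⟩
  simpa using (sq_nonneg (a 0)).trans (hbound 0)

/-- symplectic Euler scheme with `s = 1/L`, `Δ₁ = √(μ/L)`, `Δ₂ = 1/√L` on the
quadratic `f(x) = (1/2)⟨x, Ax⟩`, `A = Diag(μ, L)`: rate
`O(((1 + 2√(μ/L) − 3μ²/(4L²))/(1+2√(μ/L))²)^k)`. -/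
theorem symplectic_quadratic_both_perturbations_rate
    (μ L : ℝ) (hμ : 0 < μ) (hμL : μ < L)
    (A : (Fin 2 → ℝ) → Fin 2 → ℝ)
    (hA : ∀ y i, A y i = (if i = 0 then μ else L) * y i)
    (f : (Fin 2 → ℝ) → ℝ)
    (hf : ∀ y, f y = 1 / 2 * (μ * y 0 ^ 2 + L * y 1 ^ 2))
    (x : ℕ → Fin 2 → ℝ)
    (hrec : ∀ k, x (k + 2) = x (k + 1)
      + (1 / (1 + 2 * Real.sqrt (μ / L))) • (x (k + 1) - x k)
      - ((1 + Real.sqrt (μ / L)) / ((1 + 2 * Real.sqrt (μ / L)) * L)) • A (x (k + 1))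
      - (1 / ((1 + 2 * Real.sqrt (μ / L)) * L)) • (A (x (k + 1)) - A (x k))) :
    ∃ C, 0 ≤ C ∧ ∀ k,
      f (x k) ≤ C * ((1 + 2 * Real.sqrt (μ / L) - 3 * μ ^ 2 / (4 * L ^ 2))
        / (1 + 2 * Real.sqrt (μ / L)) ^ 2) ^ k := by
  set q := Real.sqrt (μ / L) with hq
  have hL : 0 < L := hμ.trans hμL
  have hq0 : 0 < q := Real.sqrt_pos.2 (div_pos hμ hL)
  have hq2 : q ^ 2 = μ / L := Real.sq_sqrt (div_pos hμ hL).le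
  have hq1 : q < 1 := by
    have : q ^ 2 < 1 := by rw [hq2, div_lt_one hL]; exact hμL
    nlinarith
  have hμq : μ = q ^ 2 * L := by rw [hq2]; field_simp
  have hD : 0 < 1 + 2 * q := by linarith
  have hR : 1 + 2 * q - 3 * μ ^ 2 / (4 * L ^ 2) = 1 + 2 * q - 3 / 4 * q ^ 4 := by
    rw [hμq]; field_simp
  rw [hR]
  clear_value q
  set R := 1 + 2 * q - 3 / 4 * q ^ 4 with hRdef
  have hqq : q ^ 2 < 1 := by nlinarith
  have hq4 : q ^ 4 < q ^ 2 := by nlinarith [mul_pos (pow_pos hq0 2) (sub_pos.2 hqq)]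
  have hRq : q ^ 2 < R := by nlinarith
  have hR0 : 0 < R := (pow_pos hq0 2).trans hRq
  obtain ⟨C₀, hC₀, h₀⟩ := exists_sq_le_mul_pow_of_linear_recurrence_s19
      (p := (2 + 2 * q - 2 * q ^ 2 - q ^ 3) / (1 + 2 * q)) (d := (1 - q ^ 2) / (1 + 2 * q))
      (r := R / (1 + 2 * q) ^ 2)
      (by
        rw [div_lt_div_iff₀ hD (pow_pos hD 2), ← sub_pos]
        have h : R * (1 + 2 * q) - (1 - q ^ 2) * (1 + 2 * q) ^ 2
            = (1 + 2 * q) * (q ^ 2 - q ^ 4 + 2 * q ^ 3 + 1 / 4 * q ^ 4) := by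
          rw [hRdef]; ring
        rw [h]
        have := sub_pos.2 hq4
        have : 0 < q ^ 2 - q ^ 4 + 2 * q ^ 3 + 1 / 4 * q ^ 4 := by positivity
        positivity)
      (by
        have := sub_pos.2 hqq
        positivity)
      (by
        have hu : R < (1 + 2 * q - 3 / 4 * q ^ 2) ^ 2 := by
          have h : 1 + 5 / 4 * q ≤ 1 + 2 * q - 3 / 4 * q ^ 2 := by nlinarith
          have h4 : 0 < q ^ 4 := by positivity
          nlinarith [pow_le_pow_left₀ (by positivity) h 2]
        have hpos : 0 < q ^ 3 * (q * (1 + 2 * q - 3 / 4 * q ^ 2) ^ 2 - q ^ 3 * R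
            + 4 * (1 - q ^ 2) * R) := by
          have h1 : q ^ 3 * R < q * (1 + 2 * q - 3 / 4 * q ^ 2) ^ 2 := by
            have : q ^ 2 * R < 1 * (1 + 2 * q - 3 / 4 * q ^ 2) ^ 2 := by
              nlinarith [mul_pos (sub_pos.2 hqq) hR0]
            nlinarith
          have h2 := sub_pos.2 h1
          have h3 := sub_pos.2 hqq
          positivity
        rw [← sub_pos]
        have h : (R / (1 + 2 * q) ^ 2 + (1 - q ^ 2) / (1 + 2 * q)) ^ 2
            - ((2 + 2 * q - 2 * q ^ 2 - q ^ 3) / (1 + 2 * q)) ^ 2 * (R / (1 + 2 * q) ^ 2)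
            = q ^ 3 * (q * (1 + 2 * q - 3 / 4 * q ^ 2) ^ 2 - q ^ 3 * R
              + 4 * (1 - q ^ 2) * R) / (1 + 2 * q) ^ 4 := by
          field_simp
          rw [hRdef]
          ring
        rw [h]
        positivity)
      (fun k => x k 0)
      (by
        intro k
        have h := congrFun (hrec k) 0
        simp only [Pi.add_apply, Pi.sub_apply, Pi.smul_apply, smul_eq_mul, hA, if_true] at h
        rw [h, hμq]
        field_simp
        ring)
  obtain ⟨C₁, hC₁, h₁⟩ := exists_sq_le_mul_pow_of_linear_recurrence_s19
      (p := q / (1 + 2 * q)) (d := 0) (r := R / (1 + 2 * q) ^ 2)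
      (by positivity) (by positivity)
      (by
        rw [add_zero, sq (R / (1 + 2 * q) ^ 2), div_pow]
        gcongr)
      (fun k => x k 1)
      (by
        intro k
        have h := congrFun (hrec k) 1
        simp only [Pi.add_apply, Pi.sub_apply, Pi.smul_apply, smul_eq_mul, hA, one_ne_zero,
          if_false] at h
        rw [h]
        field_simp
        ring)
  refine ⟨1 / 2 * (μ * C₀ + L * C₁), by positivity, fun k => ?_⟩
  rw [hf]
  have h0 := mul_le_mul_of_nonneg_left (h₀ k) hμ.le
  have h1 := mul_le_mul_of_nonneg_left (h₁ k) hL.le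
  linarith
end
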